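/- Let W be a symmetric and nonsingular discrete memoryless channel with R_cr < C(W). Then for any rate R with R_cr < R < C(W) there exists a constant K₁ > 0 (depending only on W and R) such that for every blocklength N ∈ ℤ⁺, the minimum maximal error probability satisfies P_e(N,R) ≤ K₁ · N^{−(1+|E_r′(R)|)/2} · exp(−N·E_r(R)), where E_r′(R) is the derivative of E_r at R. -/

import Mathlib

open Real Finset

variable {X Y : Type} [Fintype X] [Fintype Y]

/-- A discrete memoryless channel: `W x y` is the probability of output `y` given input `x`. -/
def IsDMC (W : X → Y → ℝ) : Prop :=
  (∀ x y, 0 ≤ W x y) ∧ ∀ x, ∑ y, W x y = 1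

/-- A probability distribution on a finite alphabet. -/
def IsProbDist (Q : X → ℝ) : Prop :=
  (∀ x, 0 ≤ Q x) ∧ ∑ x, Q x = 1

/-- Gallager symmetry: the output alphabet can be partitioned into classes such that within
each class every row is a permutation of every other row, and every column is a permutation
of every other column. -/
def GallagerSymmetric (W : X → Y → ℝ) : Prop :=
  ∃ cls : Y → ℕ,
    (∀ (l : ℕ) (x x' : X),
        ((Finset.univ.filter fun y => cls y = l).val.map fun y => W x y) =
        ((Finset.univ.filter fun y => cls y = l).val.map fun y => W x' y)) ∧
    (∀ y y' : Y, cls y = cls y' →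
        (Finset.univ.val.map fun x => W x y) = (Finset.univ.val.map fun x => W x y'))

/-- Singularity: whenever two inputs both give an output positive probability,
they give it the same probability. -/
def Singular (W : X → Y → ℝ) : Prop :=
  ∀ x z y, 0 < W x y * W z y → W x y = W z y

/-- Gallager's function `E_o(ρ, Q)`. -/
noncomputable def Eo (W : X → Y → ℝ) (Q : X → ℝ) (ρ : ℝ) : ℝ :=
  - Real.log (∑ y, (∑ x, Q x * W x y ^ (1 / (1 + ρ))) ^ (1 + ρ))

/-- Mutual information `I(Q; W)`. -/
noncomputable def mutualInfo (W : X → Y → ℝ) (Q : X → ℝ) : ℝ :=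
  ∑ x, ∑ y, Q x * W x y * Real.log (W x y / ∑ z, Q z * W z y)

/-- Channel capacity `C(W)`. -/
noncomputable def capacity (W : X → Y → ℝ) : ℝ :=
  sSup {r | ∃ Q, IsProbDist Q ∧ r = mutualInfo W Q}

/-- The set of values whose supremum is the sphere-packing exponent. -/
def ESPset (W : X → Y → ℝ) (R : ℝ) : Set ℝ :=
  {e | ∃ Q, IsProbDist Q ∧ ∃ ρ : ℝ, 0 ≤ ρ ∧ e = Eo W Q ρ - ρ * R}

/-- The sphere-packing exponent `E_SP(R) = max_Q sup_{ρ ≥ 0} (E_o(ρ,Q) - ρ R)`. -/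
noncomputable def ESP (W : X → Y → ℝ) (R : ℝ) : ℝ := sSup (ESPset W R)

/-- The random coding exponent `E_r(R) = max_Q max_{0 ≤ ρ ≤ 1} (E_o(ρ,Q) - ρ R)`. -/
noncomputable def Er (W : X → Y → ℝ) (R : ℝ) : ℝ :=
  sSup {e | ∃ Q, IsProbDist Q ∧ ∃ ρ : ℝ, 0 ≤ ρ ∧ ρ ≤ 1 ∧ e = Eo W Q ρ - ρ * R}

/-- `R_∞`: the supremum of rates at which the sphere-packing exponent is infinite
(i.e. the defining supremum is unbounded). -/
noncomputable def Rinf (W : X → Y → ℝ) : ℝ :=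
  sSup {R | ¬ BddAbove (ESPset W R)}

/-- The critical rate `R_cr`: the smallest rate above which `E_r = E_SP`. -/
noncomputable def Rcr (W : X → Y → ℝ) : ℝ :=
  sInf {R | ∀ R', R ≤ R' → Er W R' = ESP W R'}

/-- Number of messages of an `(N, R)` code: `⌈e^{NR}⌉`. -/
noncomputable def Mof (N : ℕ) (R : ℝ) : ℕ := ⌈Real.exp (N * R)⌉₊

/-- Error probability of message `m` for a (non-feedback) block code. -/
noncomputable def msgErrorProb (W : X → Y → ℝ) {N M : ℕ}
    (f : Fin M → Fin N → X) (φ : (Fin N → Y) → Fin M) (m : Fin M) : ℝ :=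
  ∑ y ∈ Finset.univ.filter (fun y : Fin N → Y => φ y ≠ m), ∏ n, W (f m n) (y n)

/-- Average error probability of a (non-feedback) block code. -/
noncomputable def avgErrorProb (W : X → Y → ℝ) {N M : ℕ}
    (f : Fin M → Fin N → X) (φ : (Fin N → Y) → Fin M) : ℝ :=
  (M : ℝ)⁻¹ * ∑ m, msgErrorProb W f φ m

/-- A feedback encoder, given as a function of the whole output word, is causal if the symbol
sent at time `n` depends only on the message and the outputs at times `< n`. -/
def Causal {N M : ℕ} (f : Fin M → (Fin N → Y) → Fin N → X) : Prop :=
  ∀ m y y' n, (∀ k, k < n → y k = y' k) → f m y n = f m y' n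

/-- Average error probability of a feedback code. -/
noncomputable def avgErrorProbFb (W : X → Y → ℝ) {N M : ℕ}
    (f : Fin M → (Fin N → Y) → Fin N → X) (φ : (Fin N → Y) → Fin M) : ℝ :=
  (M : ℝ)⁻¹ * ∑ m, ∑ y ∈ Finset.univ.filter (fun y : Fin N → Y => φ y ≠ m),
      ∏ n, W (f m y n) (y n)

/-- The Fejér kernel, as the Fourier transform of a triangle. -/
noncomputable def fejer (u : ℝ) : ℝ := ∫ t in (0:ℝ)..2, (1 - t / 2) * cos (t * u)

theorem fejer_of_ne_zero {u : ℝ} (hu : u ≠ 0) : fejer u = sin u ^ 2 / u ^ 2 := by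
  have hd : ∀ t ∈ Set.uIcc (0:ℝ) 2,
      HasDerivAt (fun t => (1 - t / 2) * (sin (t * u) / u) - cos (t * u) / (2 * u ^ 2))
        ((1 - t / 2) * cos (t * u)) t := by
    intro t _
    have h1 : HasDerivAt (fun t : ℝ => t * u) u t := by
      simpa using (hasDerivAt_id t).mul_const u
    have h2 : HasDerivAt (fun t : ℝ => 1 - t / 2) (-(1 / 2)) t := by
      simpa using ((hasDerivAt_id t).div_const 2).const_sub 1
    refine ((h2.mul (h1.sin.div_const u)).sub (h1.cos.div_const (2 * u ^ 2))).congr_deriv ?_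
    field_simp
    ring
  rw [fejer, intervalIntegral.integral_eq_sub_of_hasDerivAt hd
    (by apply Continuous.intervalIntegrable; fun_prop)]
  have hc : cos (2 * u) = 1 - 2 * sin u ^ 2 := by
    rw [cos_two_mul, cos_sq']; ring
  simp only [hc, zero_mul, sin_zero, cos_zero]
  field_simp
  ring

theorem fejer_zero : fejer 0 = 1 := by
  have hd : ∀ t ∈ Set.uIcc (0:ℝ) 2, HasDerivAt (fun t => t - t ^ 2 / 4) (1 - t / 2) t := by
    intro t _
    refine ((hasDerivAt_id t).sub (((hasDerivAt_id t).pow 2).div_const 4)).congr_deriv ?_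
    simp only [id_eq]; push_cast; ring
  simp only [fejer, mul_zero, cos_zero, mul_one]
  rw [intervalIntegral.integral_eq_sub_of_hasDerivAt hd
    (by apply Continuous.intervalIntegrable; fun_prop)]
  norm_num

theorem fejer_nonneg (u : ℝ) : 0 ≤ fejer u := by
  rcases eq_or_ne u 0 with rfl | hu
  · simp [fejer_zero]
  · rw [fejer_of_ne_zero hu]; positivity

theorem sq_mul_fejer (u : ℝ) : u ^ 2 * fejer u = sin u ^ 2 := by
  rcases eq_or_ne u 0 with rfl | hu
  · simp
  · rw [fejer_of_ne_zero hu]; field_simp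

theorem exp_neg_mul_abs_le_fejer {α : ℝ} (hα : 0 < α) (u : ℝ) :
    exp (-(α * |u|)) ≤ (8 + 4 / α ^ 2) * (fejer u + fejer (u + π / 2)) := by
  have h1 : (1:ℝ) ≤ (|u| + 2) ^ 2 * (fejer u + fejer (u + π / 2)) := by
    have e1 := sq_mul_fejer u
    have e2 := sq_mul_fejer (u + π / 2)
    rw [sin_add_pi_div_two] at e2
    have m1 : u ^ 2 ≤ (|u| + 2) ^ 2 := by
      rw [← sq_abs u]; gcongr; linarith
    have m2 : (u + π / 2) ^ 2 ≤ (|u| + 2) ^ 2 := by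
      rw [← sq_abs (u + π / 2)]
      gcongr
      refine (abs_add_le _ _).trans ?_
      rw [abs_of_pos (by positivity : (0:ℝ) < π / 2)]
      linarith [pi_lt_four]
    have := mul_le_mul_of_nonneg_right m1 (fejer_nonneg u)
    have := mul_le_mul_of_nonneg_right m2 (fejer_nonneg (u + π / 2))
    have := sin_sq_add_cos_sq u
    nlinarith
  have h2 : (|u| + 2) ^ 2 ≤ (8 + 4 / α ^ 2) * exp (α * |u|) := by
    have hq := quadratic_le_exp_of_nonneg (by positivity : 0 ≤ α * |u|)
    have ha : 0 ≤ α * |u| := by positivity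
    have e1 : (4 / α ^ 2) * ((α * |u|) ^ 2 / 2) = 2 * |u| ^ 2 := by field_simp; ring
    have e2 : (4 / α ^ 2) * ((α * |u|) ^ 2 / 2) ≤ (4 / α ^ 2) * exp (α * |u|) := by
      gcongr; linarith
    have e3 : 1 ≤ exp (α * |u|) := one_le_exp ha
    nlinarith [sq_nonneg (|u| - 2)]
  have hF : 0 ≤ fejer u + fejer (u + π / 2) := add_nonneg (fejer_nonneg _) (fejer_nonneg _)
  rw [exp_neg, inv_le_iff_one_le_mul₀ (exp_pos _)]
  calc 1 ≤ _ := h1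
    _ ≤ _ := mul_le_mul_of_nonneg_right h2 hF
    _ = _ := by ring

theorem norm_exp_add_exp (a b : ℝ) :
    ‖Complex.exp (a * Complex.I) + Complex.exp (b * Complex.I)‖ = 2 * |cos ((a - b) / 2)| := by
  have h : ‖Complex.exp (a * Complex.I) + Complex.exp (b * Complex.I)‖ ^ 2 =
      (2 * |cos ((a - b) / 2)|) ^ 2 := by
    rw [← Complex.normSq_eq_norm_sq, Complex.normSq_apply, mul_pow, sq_abs, cos_sq]
    simp only [Complex.add_re, Complex.add_im, Complex.exp_ofReal_mul_I_re,
      Complex.exp_ofReal_mul_I_im]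
    rw [show 2 * ((a - b) / 2) = a - b by ring, cos_sub]
    nlinarith [sin_sq_add_cos_sq a, sin_sq_add_cos_sq b]
  exact (sq_eq_sq₀ (norm_nonneg _) (by positivity)).1 h

theorem norm_charSum_le_one {q : X → ℝ} (hq : ∀ x, 0 ≤ q x) (hq1 : ∑ x, q x ≤ 1) (θ : X → ℝ) :
    ‖∑ x, (q x : ℂ) * Complex.exp (θ x * Complex.I)‖ ≤ 1 := by
  refine (norm_sum_le _ _).trans (le_trans (le_of_eq ?_) hq1)
  refine Finset.sum_congr rfl fun x _ => ?_
  rw [norm_mul, Complex.norm_exp_ofReal_mul_I, mul_one, Complex.norm_real, norm_of_nonneg (hq x)]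

theorem norm_charSum_le_exp {q : X → ℝ} (hq : ∀ x, 0 ≤ q x) (hq1 : ∑ x, q x ≤ 1)
    (v : X → ℝ) {a b : X} (hv : |v a - v b| = 1) {t : ℝ} (ht : |t| ≤ 2) :
    ‖∑ x, (q x : ℂ) * Complex.exp ((t * v x : ℝ) * Complex.I)‖ ≤
      exp (-(min (q a) (q b) / π ^ 2 * t ^ 2)) := by
  classical
  set r := min (q a) (q b) with hr
  have hr0 : 0 ≤ r := le_min (hq a) (hq b)
  have hab : a ≠ b := by rintro rfl; simp at hv
  set e : X → ℂ := fun x => Complex.exp ((t * v x : ℝ) * Complex.I) with he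
  have hne : ∀ x, ‖e x‖ = 1 := fun x => Complex.norm_exp_ofReal_mul_I _
  set p : X → ℝ := fun x => q x - (if x = a then r else 0) - (if x = b then r else 0) with hp
  have hp0 : ∀ x, 0 ≤ p x := by
    intro x
    simp only [hp]
    by_cases h1 : x = a
    · subst h1
      simp [hab, hr]
    · by_cases h2 : x = b
      · subst h2; simp [h1, hr]
      · simpa [h1, h2] using hq x
  have hsp : ∑ x, p x ≤ 1 - 2 * r := by
    simp only [hp, Finset.sum_sub_distrib, Finset.sum_ite_eq', Finset.mem_univ, if_true]
    linarith
  have hdec : ∑ x, (q x : ℂ) * e x = ∑ x, (p x : ℂ) * e x + r * (e a + e b) := by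
    have : ∀ x, (q x : ℂ) * e x = (p x : ℂ) * e x + ((if x = a then r * e x else 0) +
        (if x = b then r * e x else 0)) := by
      intro x
      simp only [hp]
      split_ifs <;> push_cast <;> ring
    simp only [this, Finset.sum_add_distrib, Finset.sum_ite_eq', Finset.mem_univ, if_true]
    ring
  have hcos : |cos ((t * v a - t * v b) / 2)| ≤ 1 - t ^ 2 / (2 * π ^ 2) := by
    have habs : |(t * v a - t * v b) / 2| = |t| / 2 := by
      rw [← mul_sub, abs_div, abs_mul, hv]; norm_num
    rw [← cos_abs, habs]
    have hpi := pi_gt_three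
    rw [abs_of_nonneg (cos_nonneg_of_mem_Icc ⟨by linarith [abs_nonneg t], by linarith⟩)]
    refine (cos_le_one_sub_mul_cos_sq (x := |t| / 2) ?_).trans (le_of_eq ?_)
    · rw [abs_of_nonneg (by positivity)]; linarith
    · rw [div_pow, sq_abs]; field_simp
  calc ‖∑ x, (q x : ℂ) * e x‖ ≤ ∑ x, p x + r * (2 * |cos ((t * v a - t * v b) / 2)|) := by
        rw [hdec]
        refine (norm_add_le _ _).trans (add_le_add ?_ ?_)
        · refine (norm_sum_le _ _).trans (le_of_eq ?_)
          refine Finset.sum_congr rfl fun x _ => ?_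
          rw [norm_mul, hne, mul_one, Complex.norm_real, norm_of_nonneg (hp0 x)]
        · rw [norm_mul, Complex.norm_real, norm_of_nonneg hr0, norm_exp_add_exp]
    _ ≤ (1 - 2 * r) + r * (2 * (1 - t ^ 2 / (2 * π ^ 2))) := by gcongr
    _ = -(r / π ^ 2 * t ^ 2) + 1 := by field_simp; ring
    _ ≤ _ := add_one_le_exp _

theorem sum_prod_mul_cos_le {ι : Type*} [Fintype ι] [DecidableEq ι] (q v : ι → X → ℝ) (t τ : ℝ) :
    ∑ x : ι → X, (∏ i, q i (x i)) * cos (t * (∑ i, v i (x i) - τ)) ≤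
      ∏ i, ‖∑ x, (q i x : ℂ) * Complex.exp ((t * v i x : ℝ) * Complex.I)‖ := by
  have h : ((∑ x : ι → X, (∏ i, q i (x i)) * cos (t * (∑ i, v i (x i) - τ)) : ℝ)) =
      (Complex.exp ((-(t * τ) : ℝ) * Complex.I) *
        ∏ i, ∑ x, (q i x : ℂ) * Complex.exp ((t * v i x : ℝ) * Complex.I)).re := by
    rw [Finset.prod_univ_sum, Fintype.piFinset_univ, Finset.mul_sum, Complex.re_sum]
    refine Finset.sum_congr rfl fun x _ => ?_
    rw [Finset.prod_mul_distrib, ← Complex.exp_sum, mul_left_comm, ← Complex.exp_add,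
      ← Complex.ofReal_prod, Complex.re_ofReal_mul, ← Finset.sum_mul, ← add_mul,
      ← Complex.ofReal_sum, ← Complex.ofReal_add, Complex.exp_ofReal_mul_I_re, ← Finset.mul_sum]
    congr 2
    ring
  rw [h]
  refine (Complex.re_le_norm _).trans ?_
  rw [norm_mul, Complex.norm_exp_ofReal_mul_I, one_mul, norm_prod]

theorem integral_exp_neg_mul_sq_le {c : ℝ} (hc : 0 < c) (n : ℕ) :
    ∫ t in (0:ℝ)..2, exp (-(c * t ^ 2)) ^ n ≤ exp (4 * c) * √(π / c) / √(n + 1) := by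
  have hn : (0:ℝ) < c * (n + 1) := by positivity
  have h_int := integrable_exp_neg_mul_sq hn
  calc ∫ t in (0:ℝ)..2, exp (-(c * t ^ 2)) ^ n
      ≤ ∫ t in (0:ℝ)..2, exp (4 * c) * exp (-(c * (n + 1)) * t ^ 2) := by
        refine intervalIntegral.integral_mono_on (by norm_num)
          (by apply Continuous.intervalIntegrable; fun_prop)
          (by apply Continuous.intervalIntegrable; fun_prop) fun t ht => ?_
        rw [← exp_nat_mul, ← exp_add, exp_le_exp]
        have : t ^ 2 ≤ 4 := by nlinarith [ht.1, ht.2]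
        nlinarith
    _ = exp (4 * c) * ∫ t in (0:ℝ)..2, exp (-(c * (n + 1)) * t ^ 2) :=
        intervalIntegral.integral_const_mul _ _
    _ ≤ exp (4 * c) * ∫ t, exp (-(c * (n + 1)) * t ^ 2) := by
        gcongr
        rw [intervalIntegral.integral_of_le (by norm_num)]
        exact MeasureTheory.setIntegral_le_integral h_int
          (Filter.Eventually.of_forall fun t => (exp_pos _).le)
    _ = _ := by
        rw [integral_gaussian, ← div_div, sqrt_div (by positivity), mul_div_assoc]

theorem sum_prod_mul_fejer_le {T : Type*} [DecidableEq T] {q v : T → X → ℝ}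
    (hq : ∀ y x, 0 ≤ q y x)
    (hq1 : ∀ y, ∑ x, q y x ≤ 1) {y₀ : T} {a b : X} (ha : 0 < q y₀ a) (hb : 0 < q y₀ b)
    (hv : |v y₀ a - v y₀ b| = 1) :
    ∃ C : ℝ, 0 < C ∧ ∀ (N : ℕ) (y : Fin N → T) (τ : ℝ),
      ∑ x : Fin N → X, (∏ i, q (y i) (x i)) * fejer (∑ i, v (y i) (x i) - τ) ≤
        C / √(#{i | y i = y₀} + 1) := by
  have hc : 0 < min (q y₀ a) (q y₀ b) / π ^ 2 := by positivity
  set c := min (q y₀ a) (q y₀ b) / π ^ 2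
  refine ⟨exp (4 * c) * √(π / c), by positivity, fun N y τ => ?_⟩
  refine le_trans ?_ (integral_exp_neg_mul_sq_le hc _)
  calc ∑ x : Fin N → X, (∏ i, q (y i) (x i)) * fejer (∑ i, v (y i) (x i) - τ)
      = ∫ t in (0:ℝ)..2, ∑ x : Fin N → X, (∏ i, q (y i) (x i)) *
          ((1 - t / 2) * cos (t * (∑ i, v (y i) (x i) - τ))) := by
        rw [intervalIntegral.integral_finsetSum
          fun x _ => by apply Continuous.intervalIntegrable; fun_prop]
        simp only [intervalIntegral.integral_const_mul, fejer]
    _ ≤ _ := by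
        refine intervalIntegral.integral_mono_on (by norm_num)
          (by apply Continuous.intervalIntegrable; fun_prop)
          (by apply Continuous.intervalIntegrable; fun_prop) fun t ht => ?_
        have e : ∑ x : Fin N → X, (∏ i, q (y i) (x i)) *
            ((1 - t / 2) * cos (t * (∑ i, v (y i) (x i) - τ))) = (1 - t / 2) *
            ∑ x : Fin N → X, (∏ i, q (y i) (x i)) * cos (t * (∑ i, v (y i) (x i) - τ)) := by
          rw [Finset.mul_sum]
          exact Finset.sum_congr rfl fun x _ => by ring
        have hprod := sum_prod_mul_cos_le (fun i => q (y i)) (fun i => v (y i)) t τ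
        set P := ∏ i, ‖∑ x, (q (y i) x : ℂ) * Complex.exp ((t * v (y i) x : ℝ) * Complex.I)‖
        have hP0 : 0 ≤ P := by positivity
        have ht2 : 0 ≤ 1 - t / 2 := by linarith [ht.2]
        rw [e]
        calc _ ≤ (1 - t / 2) * P := by gcongr
          _ ≤ P := mul_le_of_le_one_left hP0 (by linarith [ht.1])
          _ ≤ ∏ i, if y i = y₀ then exp (-(c * t ^ 2)) else 1 := by
            refine Finset.prod_le_prod (fun _ _ => norm_nonneg _) fun i _ => ?_
            split_ifs with h
            · rw [h]
              exact norm_charSum_le_exp (hq _) (hq1 _) _ hv (abs_le.2 ⟨by linarith [ht.1], ht.2⟩)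
            · exact norm_charSum_le_one (hq _) (hq1 _) _
          _ = _ := by rw [← Finset.prod_filter, Finset.prod_const]

/-- Anticoncentration: a sum of independent variables, each of which is one of finitely many types
(indexed by `y`), spreads out at scale `√n`, where `n` counts the variables of a fixed
nondegenerate type `y₀`. -/
theorem sum_prod_mul_exp_neg_abs_le {T : Type*} [DecidableEq T] {q v : T → X → ℝ}
    (hq : ∀ y x, 0 ≤ q y x)
    (hq1 : ∀ y, ∑ x, q y x ≤ 1) {y₀ : T} {a b : X} (ha : 0 < q y₀ a) (hb : 0 < q y₀ b)
    (hv : v y₀ a ≠ v y₀ b) {α : ℝ} (hα : 0 < α) :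
    ∃ C : ℝ, 0 < C ∧ ∀ (N : ℕ) (y : Fin N → T) (τ : ℝ),
      ∑ x : Fin N → X, (∏ i, q (y i) (x i)) * exp (-(α * |∑ i, v (y i) (x i) - τ|)) ≤
        C / √(#{i | y i = y₀} + 1) := by
  have hδ : 0 < |v y₀ a - v y₀ b| := abs_pos.2 (sub_ne_zero.2 hv)
  set δ := |v y₀ a - v y₀ b| with hδd
  obtain ⟨C, hC, h⟩ := sum_prod_mul_fejer_le (v := fun y x => v y x / δ) hq hq1 ha hb
    (by rw [← sub_div, abs_div, abs_of_pos hδ, ← hδd, div_self hδ.ne'])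
  have hαδ : 0 < α * δ := by positivity
  refine ⟨(8 + 4 / (α * δ) ^ 2) * (C + C), by positivity, fun N y τ => ?_⟩
  have key : ∀ x : Fin N → X, (∏ i, q (y i) (x i)) * exp (-(α * |∑ i, v (y i) (x i) - τ|)) ≤
      (8 + 4 / (α * δ) ^ 2) * ((∏ i, q (y i) (x i)) * fejer (∑ i, v (y i) (x i) / δ - τ / δ) +
        (∏ i, q (y i) (x i)) * fejer (∑ i, v (y i) (x i) / δ - (τ / δ - π / 2))) := by
    intro x
    have hP : 0 ≤ ∏ i, q (y i) (x i) := Finset.prod_nonneg fun i _ => hq _ _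
    have h1 := exp_neg_mul_abs_le_fejer hαδ (∑ i, v (y i) (x i) / δ - τ / δ)
    have h2 : α * δ * |∑ i, v (y i) (x i) / δ - τ / δ| = α * |∑ i, v (y i) (x i) - τ| := by
      rw [← Finset.sum_div, ← sub_div, abs_div, abs_of_pos hδ]; field_simp
    rw [h2] at h1
    refine (mul_le_mul_of_nonneg_left h1 hP).trans (le_of_eq ?_)
    rw [sub_sub_eq_add_sub, sub_add_eq_add_sub]
    ring
  refine (Finset.sum_le_sum fun x _ => key x).trans ?_
  rw [← Finset.mul_sum, Finset.sum_add_distrib, mul_div_assoc, add_div]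
  gcongr
  · exact h N y _
  · exact h N y _

theorem sum_pi_prod_mul_apply {ι A : Type*} [Fintype ι] [DecidableEq ι] [Fintype A] {w : A → ℝ}
    (hw : ∑ a, w a = 1) (G : A → ℝ) (i : ι) :
    ∑ c : ι → A, (∏ j, w (c j)) * G (c i) = ∑ a, w a * G a := by
  have h : ∀ c : ι → A, (∏ j, w (c j)) * G (c i) =
      ∏ j, w (c j) * (if j = i then G (c j) else 1) := by
    intro c
    rw [Finset.prod_mul_distrib, Finset.prod_ite_eq' univ i fun j => G (c j)]
    simp
  simp only [h]
  rw [← Fintype.piFinset_univ,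
    ← Finset.prod_univ_sum (fun _ => univ) fun j a => w a * if j = i then G a else 1,
    Finset.prod_eq_single i (fun j _ hj => by simp [hj, hw]) (by simp)]
  simp

theorem sum_pi_prod_mul_apply₂ {ι A : Type*} [Fintype ι] [DecidableEq ι] [Fintype A] {w : A → ℝ}
    (hw : ∑ a, w a = 1) (G : A → A → ℝ) {i k : ι} (hik : k ≠ i) :
    ∑ c : ι → A, (∏ j, w (c j)) * G (c i) (c k) = ∑ a, w a * ∑ b, w b * G a b := by
  classical
  have h : ∀ c : ι → A, (∏ j, w (c j)) * G (c i) (c k) = ∑ a,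
      ∏ j, w (c j) * ((if j = i then (if c j = a then 1 else 0) else 1) *
        (if j = k then G a (c j) else 1)) := by
    intro c
    have : ∀ a, ∏ j, w (c j) * ((if j = i then (if c j = a then 1 else 0) else 1) *
        (if j = k then G a (c j) else 1)) =
        if c i = a then (∏ j, w (c j)) * G a (c k) else 0 := by
      intro a
      rw [Finset.prod_mul_distrib, Finset.prod_mul_distrib,
        Finset.prod_ite_eq' univ i fun j => if c j = a then (1:ℝ) else 0,
        Finset.prod_ite_eq' univ k fun j => G a (c j)]
      simp
    rw [Finset.sum_congr rfl fun a _ => this a]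
    simp
  simp only [h]
  rw [Finset.sum_comm]
  refine Finset.sum_congr rfl fun a _ => ?_
  rw [← Fintype.piFinset_univ, ← Finset.prod_univ_sum (fun _ => univ) fun j b => w b *
      ((if j = i then (if b = a then 1 else 0) else 1) * (if j = k then G a b else 1)),
    Finset.prod_eq_mul i k hik.symm (fun j _ hj => by simp [hj.1, hj.2, hw]) (by simp) (by simp)]
  simp [hik, hik.symm]

/-- Random coding union bound for the ensemble of i.i.d. codewords. -/
theorem sum_pi_prod_mul_unionError_le {ι A B : Type*} [Fintype ι] [DecidableEq ι] [Fintype A]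
    [Fintype B] {V : A → B → ℝ} (hV : ∀ a b, 0 ≤ V a b) {w : A → ℝ} (hw0 : ∀ a, 0 ≤ w a)
    (hw : ∑ a, w a = 1) (m : ι) :
    ∑ c : ι → A, (∏ j, w (c j)) *
        (∑ y, open Classical in if ∃ k ≠ m, V (c m) y ≤ V (c k) y then V (c m) y else 0) ≤
      ∑ y, ∑ x, w x * V x y * min 1 (Fintype.card ι * ∑ z with V x y ≤ V z y, w z) := by
  classical
  have hT : ∀ x y, 0 ≤ ∑ z with V x y ≤ V z y, w z := fun x y => sum_nonneg fun z _ => hw0 z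
  set K : ℝ := (Fintype.card ι : ℝ)
  simp only [Finset.mul_sum (s := (univ : Finset B))]
  rw [Finset.sum_comm]
  refine Finset.sum_le_sum fun y _ => ?_
  set T : A → ℝ := fun x => ∑ z with V x y ≤ V z y, w z with hTd
  have step : ∀ c : ι → A, (if ∃ k ≠ m, V (c m) y ≤ V (c k) y then V (c m) y else 0) ≤
      (if K * T (c m) ≤ 1 then 0 else V (c m) y) + ∑ k ∈ univ.erase m,
        (if K * T (c m) ≤ 1 then if V (c m) y ≤ V (c k) y then V (c m) y else 0 else 0) := by
    intro c
    have hnn : ∀ k ∈ univ.erase m,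
        0 ≤ if V (c m) y ≤ V (c k) y then V (c m) y else 0 := by
      intro k _; split_ifs <;> simp [hV]
    by_cases hg : K * T (c m) ≤ 1
    · simp only [hg, if_true, zero_add]
      split_ifs with he
      · obtain ⟨k, hk, hle⟩ := he
        refine le_trans ?_ (single_le_sum hnn (mem_erase.2 ⟨hk, mem_univ k⟩))
        simp [hle]
      · exact sum_nonneg hnn
    · simp only [hg, if_false, sum_const_zero, add_zero]
      split_ifs <;> simp [hV]
  calc ∑ c : ι → A, (∏ j, w (c j)) * (if ∃ k ≠ m, V (c m) y ≤ V (c k) y then V (c m) y else 0)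
      ≤ ∑ c : ι → A, (∏ j, w (c j)) * ((if K * T (c m) ≤ 1 then 0 else V (c m) y) +
          ∑ k ∈ univ.erase m,
        (if K * T (c m) ≤ 1 then if V (c m) y ≤ V (c k) y then V (c m) y else 0 else 0)) :=
        sum_le_sum fun c _ => mul_le_mul_of_nonneg_left (step c) (prod_nonneg fun j _ => hw0 _)
    _ = ∑ x, w x * (if K * T x ≤ 1 then 0 else V x y) + ∑ k ∈ univ.erase m,
          ∑ x, w x * ∑ z, w z *
            (if K * T x ≤ 1 then if V x y ≤ V z y then V x y else 0 else 0) := by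
        simp only [mul_add, Finset.sum_add_distrib, Finset.mul_sum (s := univ.erase m)]
        congr 1
        · exact sum_pi_prod_mul_apply hw (fun x => if K * T x ≤ 1 then 0 else V x y) m
        · rw [Finset.sum_comm]
          refine sum_congr rfl fun k hk => ?_
          exact sum_pi_prod_mul_apply₂ hw (fun x z => if K * T x ≤ 1 then
            if V x y ≤ V z y then V x y else 0 else 0) (mem_erase.1 hk).1
    _ = ∑ x, w x * ((if K * T x ≤ 1 then 0 else V x y) +
          (#(univ.erase m) : ℝ) * (if K * T x ≤ 1 then V x y * T x else 0)) := by
        rw [sum_const, nsmul_eq_mul, Finset.mul_sum, ← Finset.sum_add_distrib]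
        refine sum_congr rfl fun x _ => ?_
        have : ∑ z, w z * (if K * T x ≤ 1 then if V x y ≤ V z y then V x y else 0 else 0) =
            if K * T x ≤ 1 then V x y * T x else 0 := by
          split_ifs
          · simp only [hTd, Finset.sum_filter, Finset.mul_sum]
            refine sum_congr rfl fun z _ => ?_
            split_ifs <;> ring
          · simp
        rw [this]
        ring
    _ ≤ ∑ x, w x * V x y * min 1 (K * T x) := by
        refine sum_le_sum fun x _ => ?_
        rw [mul_assoc]
        refine mul_le_mul_of_nonneg_left ?_ (hw0 x)
        have hcard : (#(univ.erase m) : ℝ) ≤ K := Nat.cast_le.2 (card_le_univ _)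
        split_ifs with hg
        · rw [min_eq_right hg, zero_add, mul_left_comm]
          exact mul_le_mul_of_nonneg_left
            (mul_le_mul_of_nonneg_right hcard (hT x y)) (hV x y)
        · rw [min_eq_left (not_le.1 hg).le, mul_one, mul_zero, add_zero]

/-- If the random coding union bound for `2 * M` codewords is at most `ε`, then some code with `M`
messages has maximal error probability at most `2 * ε`. -/
theorem exists_code_of_unionBound_le {A B : Type*} [Fintype A] [Fintype B] {V : A → B → ℝ}
    (hV : ∀ a b, 0 ≤ V a b) {w : A → ℝ} (hw0 : ∀ a, 0 ≤ w a) (hw : ∑ a, w a = 1) {M : ℕ}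
    (hM : 0 < M) {ε : ℝ} (hε : 0 < ε)
    (h : ∑ y, ∑ x, w x * V x y * min 1 ((2 * M : ℕ) * ∑ z with V x y ≤ V z y, w z) ≤ ε) :
    ∃ (f : Fin M → A) (φ : B → Fin M), ∀ m, ∑ y with φ y ≠ m, V (f m) y ≤ 2 * ε := by
  classical
  set err : (Fin (2 * M) → A) → Fin (2 * M) → ℝ := fun c m =>
    ∑ y, if ∃ k ≠ m, V (c m) y ≤ V (c k) y then V (c m) y else 0 with herr
  have herr0 : ∀ c m, 0 ≤ err c m := fun c m =>
    sum_nonneg fun y _ => by split_ifs <;> simp [hV]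
  have hwc0 : ∀ c : Fin (2 * M) → A, 0 ≤ ∏ j, w (c j) := fun c => prod_nonneg fun j _ => hw0 _
  have hwc : ∑ c : Fin (2 * M) → A, ∏ j, w (c j) = 1 := by
    rw [← Fintype.piFinset_univ, ← Finset.prod_univ_sum (fun _ => univ) fun _ a => w a]
    simp [hw]
  have hM' : (0:ℝ) < M := by exact_mod_cast hM
  obtain ⟨c, hc⟩ : ∃ c : Fin (2 * M) → A, ∑ m, err c m ≤ 2 * M * ε := by
    by_contra! hcon
    have h1 : ∑ c : Fin (2 * M) → A, (∏ j, w (c j)) * ∑ m, err c m ≤ 2 * M * ε := by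
      simp only [Finset.mul_sum]
      rw [Finset.sum_comm]
      calc _ ≤ ∑ m : Fin (2 * M), ε := sum_le_sum fun m _ => by
            refine le_trans ?_ h
            have := sum_pi_prod_mul_unionError_le hV hw0 hw m
            rw [Fintype.card_fin] at this
            refine le_trans (le_of_eq ?_) this
            simp only [herr]
            congr!
        _ = _ := by simp
    have h2 : ∑ c : Fin (2 * M) → A, (∏ j, w (c j)) * (2 * M * ε) <
        ∑ c : Fin (2 * M) → A, (∏ j, w (c j)) * ∑ m, err c m := by
      obtain ⟨c, -, hc⟩ : ∃ c ∈ (univ : Finset (Fin (2 * M) → A)), 0 < ∏ j, w (c j) := by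
        by_contra! hall
        have := sum_nonpos hall
        rw [hwc] at this
        linarith
      exact sum_lt_sum (fun c _ => mul_le_mul_of_nonneg_left (hcon c).le (hwc0 c))
        ⟨c, mem_univ c, mul_lt_mul_of_pos_left (hcon c) hc⟩
    rw [← Finset.sum_mul, hwc, one_mul] at h2
    linarith
  have hbad : #{m | 2 * ε < err c m} < M := by
    by_contra! hcard
    have h1 : (M : ℝ) * (2 * ε) < ∑ m, err c m := by
      calc (M : ℝ) * (2 * ε) ≤ #{m | 2 * ε < err c m} * (2 * ε) := by gcongr
        _ = ∑ m with 2 * ε < err c m, 2 * ε := by simp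
        _ < ∑ m with 2 * ε < err c m, err c m := by
          refine sum_lt_sum_of_nonempty (card_pos.1 (hM.trans_le hcard)) fun m hm => ?_
          exact (mem_filter.1 hm).2
        _ ≤ _ := sum_le_sum_of_subset_of_nonneg (filter_subset _ _) fun m _ _ => herr0 c m
    linarith
  have hgood : M ≤ #{m | err c m ≤ 2 * ε} := by
    have := card_filter_add_card_filter_not (s := univ) fun m => 2 * ε < err c m
    simp only [not_lt, card_univ, Fintype.card_fin] at this
    lia
  obtain ⟨s, hs, hsM⟩ := exists_subset_card_eq hgood
  set e : Fin M ↪o Fin (2 * M) := s.orderEmbOfFin hsM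
  have : Nonempty (Fin M) := ⟨⟨0, hM⟩⟩
  choose φ hφ using fun y => Finite.exists_max fun m : Fin M => V (c (e m)) y
  refine ⟨fun m => c (e m), φ, fun m => ?_⟩
  refine le_trans ?_ (mem_filter.1 (hs (s.orderEmbOfFin_mem hsM m))).2
  rw [Finset.sum_filter]
  refine sum_le_sum fun y _ => ?_
  split_ifs with h1 h2
  · exact le_rfl
  · exact absurd ⟨e (φ y), fun hh => h1 (e.injective hh), hφ y m⟩ h2
  · exact hV _ _
  · exact le_rfl

theorem sum_prod_mul_inv_count_le {T : Type*} [Fintype T] [DecidableEq T] {w : T → ℝ}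
    (hw : ∀ y, 0 ≤ w y) (hw1 : ∑ y, w y = 1) {y₀ : T} (h0 : 0 < w y₀) (N : ℕ) :
    ∑ y : Fin N → T, (∏ i, w (y i)) * (1 / (#{i | y i = y₀} + 1 : ℝ)) ≤
      1 / (w y₀ * (N + 1)) := by
  have h_int : ∀ n : ℕ, 1 / (n + 1 : ℝ) = ∫ t in (0:ℝ)..1, t ^ n := by
    intro n; rw [integral_pow]; simp
  have hgen : ∀ t : ℝ, ∑ y : Fin N → T, (∏ i, w (y i)) * t ^ #{i | y i = y₀} =
      (1 - w y₀ + w y₀ * t) ^ N := by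
    intro t
    have h1 : ∀ y : Fin N → T, (∏ i, w (y i)) * t ^ #{i | y i = y₀} =
        ∏ i, w (y i) * (if y i = y₀ then t else 1) := by
      intro y
      rw [Finset.prod_mul_distrib, ← Finset.prod_filter, Finset.prod_const]
    simp only [h1]
    rw [← Fintype.piFinset_univ,
      ← Finset.prod_univ_sum (fun _ => univ) fun _ a => w a * if a = y₀ then t else 1]
    have h2 : ∀ a, w a * (if a = y₀ then t else 1) =
        w a + (if a = y₀ then w a * (t - 1) else 0) := by
      intro a; split_ifs <;> ring
    simp only [h2, Finset.sum_add_distrib, hw1, Finset.sum_ite_eq', mem_univ, if_true, prod_const,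
      card_univ, Fintype.card_fin]
    ring
  have hd : ∀ t ∈ Set.uIcc (0:ℝ) 1, HasDerivAt
      (fun t => (1 - w y₀ + w y₀ * t) ^ (N + 1) / (w y₀ * (N + 1)))
      ((1 - w y₀ + w y₀ * t) ^ N) t := by
    intro t _
    have h1 : HasDerivAt (fun t => 1 - w y₀ + w y₀ * t) (w y₀) t := by
      simpa using ((hasDerivAt_id t).const_mul (w y₀)).const_add (1 - w y₀)
    refine ((h1.pow (N + 1)).div_const _).congr_deriv ?_
    have : (N + 1 : ℝ) ≠ 0 := by positivity
    simp only [Nat.add_sub_cancel]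
    push_cast
    field_simp
  have hle : w y₀ ≤ 1 := hw1 ▸ single_le_sum (fun y _ => hw y) (mem_univ y₀)
  calc ∑ y : Fin N → T, (∏ i, w (y i)) * (1 / (#{i | y i = y₀} + 1 : ℝ))
      = ∫ t in (0:ℝ)..1, ∑ y : Fin N → T, (∏ i, w (y i)) * t ^ #{i | y i = y₀} := by
        rw [intervalIntegral.integral_finsetSum
          fun x _ => by apply Continuous.intervalIntegrable; fun_prop]
        simp only [intervalIntegral.integral_const_mul, h_int]
    _ = (1 - (1 - w y₀) ^ (N + 1)) / (w y₀ * (N + 1)) := by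
        simp only [hgen]
        rw [intervalIntegral.integral_eq_sub_of_hasDerivAt hd
          (by apply Continuous.intervalIntegrable; fun_prop)]
        simp [sub_div]
    _ ≤ _ := by
        gcongr
        linarith [pow_nonneg (sub_nonneg.2 hle) (N + 1)]

theorem sum_prod_mul_count_rpow_le {T : Type*} [Fintype T] [DecidableEq T] {w : T → ℝ}
    (hw : ∀ y, 0 ≤ w y) (hw1 : ∑ y, w y = 1) {y₀ : T} (h0 : 0 < w y₀) {N : ℕ} (hN : 0 < N)
    {γ : ℝ} (hγ0 : 0 < γ) (hγ1 : γ ≤ 1) :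
    ∑ y : Fin N → T, (∏ i, w (y i)) * (#{i | y i = y₀} + 1 : ℝ) ^ (-γ) ≤
      w y₀ ^ (-γ) * (N : ℝ) ^ (-γ) := by
  have hN' : (0:ℝ) < N := by exact_mod_cast hN
  have hwN : ∑ y : Fin N → T, ∏ i, w (y i) = 1 := by
    rw [← Fintype.piFinset_univ, ← Finset.prod_univ_sum (fun _ => univ) fun _ a => w a]
    simp [hw1]
  have hJ := arith_mean_le_rpow_mean univ (fun y : Fin N → T => ∏ i, w (y i))
    (fun y => (#{i | y i = y₀} + 1 : ℝ) ^ (-γ)) (fun y _ => prod_nonneg fun i _ => hw _) hwN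
    (fun y _ => by positivity) (one_le_inv_iff₀.2 ⟨hγ0, hγ1⟩)
  refine hJ.trans ?_
  have hpow : ∀ y : Fin N → T, ((#{i | y i = y₀} + 1 : ℝ) ^ (-γ)) ^ γ⁻¹ =
      1 / (#{i | y i = y₀} + 1 : ℝ) := by
    intro y
    rw [← rpow_mul (by positivity), neg_mul, mul_inv_cancel₀ hγ0.ne', rpow_neg_one, one_div]
  simp only [hpow]
  rw [← mul_rpow h0.le hN'.le, one_div, inv_inv, rpow_neg (by positivity),
    ← inv_rpow (by positivity)]
  refine rpow_le_rpow (sum_nonneg fun y _ => mul_nonneg (prod_nonneg fun i _ => hw _)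
    (by positivity)) ?_ hγ0.le
  refine (sum_prod_mul_inv_count_le hw hw1 h0 N).trans ?_
  rw [one_div]
  gcongr
  linarith


/-- The output weight `∑ x, Q x * W x y ^ s` appearing in Gallager's function. -/
noncomputable def outputWeight (W : X → Y → ℝ) (Q : X → ℝ) (s : ℝ) (y : Y) : ℝ :=
  ∑ x, Q x * W x y ^ s

/-- The tilted backward channel, proportional to `Q x * W x y ^ s`. -/
noncomputable def tiltedBackward (W : X → Y → ℝ) (Q : X → ℝ) (s : ℝ) (y : Y) (x : X) : ℝ :=
  Q x * W x y ^ s / outputWeight W Q s y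

section Tilting

variable {U T : Type} [Fintype U] {W : U → T → ℝ} {Q : U → ℝ}

theorem outputWeight_nonneg (hW : ∀ x y, 0 ≤ W x y) (hQ : ∀ x, 0 ≤ Q x) (s : ℝ) (y : T) :
    0 ≤ outputWeight W Q s y :=
  sum_nonneg fun x _ => mul_nonneg (hQ x) (rpow_nonneg (hW x y) s)

theorem outputWeight_pos (hW : ∀ x y, 0 ≤ W x y) (hQ : ∀ x, 0 ≤ Q x) {s : ℝ} {x : U} {y : T}
    (hx : 0 < Q x) (hxy : 0 < W x y) : 0 < outputWeight W Q s y :=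
  (mul_pos hx (rpow_pos_of_pos hxy s)).trans_le <|
    single_le_sum (f := fun x => Q x * W x y ^ s)
      (fun x _ => mul_nonneg (hQ x) (rpow_nonneg (hW x y) s)) (mem_univ x)

theorem tiltedBackward_nonneg (hW : ∀ x y, 0 ≤ W x y) (hQ : ∀ x, 0 ≤ Q x) (s : ℝ) (y : T) (x : U) :
    0 ≤ tiltedBackward W Q s y x :=
  div_nonneg (mul_nonneg (hQ x) (rpow_nonneg (hW x y) s)) (outputWeight_nonneg hW hQ s y)

theorem sum_tiltedBackward_le_one (s : ℝ) (y : T) : ∑ x, tiltedBackward W Q s y x ≤ 1 := by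
  simp only [tiltedBackward, ← Finset.sum_div]
  exact div_self_le_one _

theorem outputWeight_mul_tiltedBackward (hW : ∀ x y, 0 ≤ W x y) (hQ : ∀ x, 0 ≤ Q x) (s : ℝ)
    (y : T) (x : U) : outputWeight W Q s y * tiltedBackward W Q s y x = Q x * W x y ^ s := by
  rcases eq_or_ne (outputWeight W Q s y) 0 with h | h
  · rw [h, zero_mul]
    exact ((sum_eq_zero_iff_of_nonneg fun x _ =>
      mul_nonneg (hQ x) (rpow_nonneg (hW x y) s)).1 h x (mem_univ x)).symm
  · rw [tiltedBackward]; field_simp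

theorem prod_outputWeight_mul_prod_tiltedBackward (hW : ∀ x y, 0 ≤ W x y) (hQ : ∀ x, 0 ≤ Q x)
    (s : ℝ) {N : ℕ} (x : Fin N → U) (y : Fin N → T) :
    (∏ i, outputWeight W Q s (y i)) * ∏ i, tiltedBackward W Q s (y i) (x i) =
      (∏ i, Q (x i)) * (∏ i, W (x i) (y i)) ^ s := by
  rw [← Finset.prod_mul_distrib, ← finsetProd_rpow _ _ fun i _ => hW _ _,
    ← Finset.prod_mul_distrib]
  exact prod_congr rfl fun i _ => outputWeight_mul_tiltedBackward hW hQ s _ _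

/-- Bound on the probability that an independent codeword beats the likelihood of `x`. -/
theorem sum_competitors_le (hW : ∀ x y, 0 ≤ W x y) (hQ : ∀ x, 0 ≤ Q x) {s D : ℝ} {N : ℕ}
    {y : Fin N → T}
    (hD : ∀ τ, ∑ z : Fin N → U, (∏ i, tiltedBackward W Q s (y i) (z i)) *
      exp (-(s * |∑ i, log (W (z i) (y i)) - τ|)) ≤ D)
    {x : Fin N → U} (hx : 0 < ∏ i, W (x i) (y i)) :
    ∑ z : Fin N → U with ∏ i, W (x i) (y i) ≤ ∏ i, W (z i) (y i), ∏ i, Q (z i) ≤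
      (∏ i, outputWeight W Q s (y i)) * D * (∏ i, W (x i) (y i)) ^ (-s) := by
  set G := ∏ i, outputWeight W Q s (y i)
  set V : (Fin N → U) → ℝ := fun z => ∏ i, W (z i) (y i) with hVd
  have hG : 0 ≤ G := prod_nonneg fun i _ => outputWeight_nonneg hW hQ s _
  have hq : ∀ z : Fin N → U, 0 ≤ ∏ i, tiltedBackward W Q s (y i) (z i) := fun z =>
    prod_nonneg fun i _ => tiltedBackward_nonneg hW hQ s _ _
  change 0 < V x at hx
  change ∑ z with V x ≤ V z, ∏ i, Q (z i) ≤ G * D * V x ^ (-s)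
  have hterm : ∀ z ∈ univ.filter fun z => V x ≤ V z, ∏ i, Q (z i) = G * V x ^ (-s) *
      ((∏ i, tiltedBackward W Q s (y i) (z i)) *
        exp (-(s * |∑ i, log (W (z i) (y i)) - log (V x)|))) := by
    intro z hz
    have hle : V x ≤ V z := (mem_filter.1 hz).2
    have hz : 0 < V z := hx.trans_le hle
    have hlog : ∑ i, log (W (z i) (y i)) = log (V z) :=
      (log_prod fun i _ h0 => hz.ne' (prod_eq_zero (mem_univ i) h0)).symm
    have habs : |log (V z) - log (V x)| = log (V z) - log (V x) :=
      abs_of_nonneg (sub_nonneg.2 (log_le_log hx hle))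
    have hfac : G * ∏ i, tiltedBackward W Q s (y i) (z i) = (∏ i, Q (z i)) * V z ^ s :=
      prod_outputWeight_mul_prod_tiltedBackward hW hQ s z y
    have hexp : V x ^ (-s) * exp (-(s * (log (V z) - log (V x)))) = (V z ^ s)⁻¹ := by
      rw [rpow_def_of_pos hx, rpow_def_of_pos hz, ← exp_add, ← exp_neg]
      congr 1; ring
    rw [hlog, habs]
    calc ∏ i, Q (z i) = ((∏ i, Q (z i)) * V z ^ s) * (V z ^ s)⁻¹ := by
          rw [mul_inv_cancel_right₀ (rpow_pos_of_pos hz s).ne']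
      _ = _ := by rw [← hfac, ← hexp]; ring
  rw [sum_congr rfl hterm, ← Finset.mul_sum, mul_right_comm G D]
  refine mul_le_mul_of_nonneg_left ?_ (by positivity)
  refine le_trans (sum_le_sum_of_subset_of_nonneg (filter_subset _ _) fun z _ _ => ?_) (hD _)
  exact mul_nonneg (hq z) (exp_pos _).le

theorem min_one_exp_le {ρ l : ℝ} : min 1 (exp l) ≤ exp (ρ * l - min ρ (1 - ρ) * |l|) := by
  rcases le_total 0 l with hl | hl
  · refine (min_le_left _ _).trans (one_le_exp ?_)
    rw [abs_of_nonneg hl, ← sub_mul]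
    exact mul_nonneg (sub_nonneg.2 (min_le_left _ _)) hl
  · refine (min_le_right _ _).trans (exp_le_exp.2 ?_)
    rw [abs_of_nonpos hl]
    nlinarith [min_le_right ρ (1 - ρ)]

/-- The contribution of a single output word to the random coding union bound. -/
theorem sum_unionBound_le (hW : ∀ x y, 0 ≤ W x y) (hQ : ∀ x, 0 ≤ Q x) {ρ s D E K : ℝ}
    (hρ0 : 0 < ρ) (hs : s = 1 / (1 + ρ)) (hD0 : 0 < D) (hK : 0 < K)
    {N : ℕ} {y : Fin N → T}
    (hD : ∀ τ, ∑ z : Fin N → U, (∏ i, tiltedBackward W Q s (y i) (z i)) *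
      exp (-(s * |∑ i, log (W (z i) (y i)) - τ|)) ≤ D)
    (hE : ∀ τ, ∑ z : Fin N → U, (∏ i, tiltedBackward W Q s (y i) (z i)) *
      exp (-(min ρ (1 - ρ) * s * |∑ i, log (W (z i) (y i)) - τ|)) ≤ E) :
    ∑ x : Fin N → U, (∏ i, Q (x i)) * (∏ i, W (x i) (y i)) * min 1 (K *
        ∑ z : Fin N → U with ∏ i, W (x i) (y i) ≤ ∏ i, W (z i) (y i), ∏ i, Q (z i)) ≤
      (K * D) ^ ρ * (∏ i, outputWeight W Q s (y i)) ^ (1 + ρ) * E := by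
  have hs0 : 0 < s := by rw [hs]; positivity
  set G := ∏ i, outputWeight W Q s (y i) with hGd
  have hG : 0 ≤ G := prod_nonneg fun i _ => outputWeight_nonneg hW hQ s _
  have hq : ∀ z : Fin N → U, 0 ≤ ∏ i, tiltedBackward W Q s (y i) (z i) := fun z =>
    prod_nonneg fun i _ => tiltedBackward_nonneg hW hQ s _ _
  have hQN : ∀ z : Fin N → U, 0 ≤ ∏ i, Q (z i) := fun z => prod_nonneg fun i _ => hQ _
  have hVN : ∀ z : Fin N → U, 0 ≤ ∏ i, W (z i) (y i) := fun z => prod_nonneg fun i _ => hW _ _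
  set B := K * D * G with hB
  set β := min ρ (1 - ρ)
  have hterm : ∀ x : Fin N → U, (∏ i, Q (x i)) * (∏ i, W (x i) (y i)) * min 1 (K *
      ∑ z : Fin N → U with ∏ i, W (x i) (y i) ≤ ∏ i, W (z i) (y i), ∏ i, Q (z i)) ≤
      (K * D) ^ ρ * G ^ (1 + ρ) * ((∏ i, tiltedBackward W Q s (y i) (x i)) *
        exp (-(β * s * |∑ i, log (W (x i) (y i)) - log B / s|))) := by
    intro x
    have hrhs : 0 ≤ (K * D) ^ ρ * G ^ (1 + ρ) * ((∏ i, tiltedBackward W Q s (y i) (x i)) *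
        exp (-(β * s * |∑ i, log (W (x i) (y i)) - log B / s|))) := by
      have := hq x
      positivity
    have hfac : G * ∏ i, tiltedBackward W Q s (y i) (x i) =
        (∏ i, Q (x i)) * (∏ i, W (x i) (y i)) ^ s :=
      prod_outputWeight_mul_prod_tiltedBackward hW hQ s x y
    set P := ∏ i, Q (x i)
    rcases (hVN x).eq_or_lt with h0 | hV
    · rw [← h0]; simpa using hrhs
    have hlog : ∑ i, log (W (x i) (y i)) = log (∏ i, W (x i) (y i)) :=
      (log_prod fun i _ h0 => hV.ne' (prod_eq_zero (mem_univ i) h0)).symm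
    have htail := sum_competitors_le hW hQ hD hV
    rw [← hGd] at htail
    rw [hlog] at hrhs ⊢
    set V := ∏ i, W (x i) (y i)
    rcases hG.eq_or_lt with h0 | hG0
    · rw [← h0, zero_mul] at hfac
      have : P = 0 := (mul_eq_zero.1 hfac.symm).resolve_right (rpow_pos_of_pos hV s).ne'
      rw [this]; simpa using hrhs
    have hB0 : 0 < B := by positivity
    have hA : B * V ^ (-s) = exp (log B - s * log V) := by
      rw [exp_sub, exp_log hB0, rpow_neg hV.le, rpow_def_of_pos hV, mul_comm s, div_eq_mul_inv]
    have habs : |log B - s * log V| = s * |log V - log B / s| := by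
      rw [abs_sub_comm, ← abs_of_pos hs0, ← abs_mul, abs_of_pos hs0]
      congr 1; field_simp
    have h1 : min 1 (K * ∑ z : Fin N → U with V ≤ ∏ i, W (z i) (y i), ∏ i, Q (z i)) ≤
        exp (ρ * (log B - s * log V) - β * |log B - s * log V|) := by
      refine le_trans (min_le_min_left _ ?_) min_one_exp_le
      rw [← hA]
      calc _ ≤ K * (G * D * V ^ (-s)) := by gcongr
        _ = _ := by rw [hB]; ring
    have h2 : V * exp (ρ * (log B - s * log V)) = B ^ ρ * V ^ s := by
      nth_rewrite 1 [← exp_log hV]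
      rw [rpow_def_of_pos hB0, rpow_def_of_pos hV, ← exp_add, ← exp_add]
      congr 1
      have : ρ * s = 1 - s := by rw [hs]; field_simp; ring
      linear_combination (-log V) * this
    calc _ ≤ P * V * exp (ρ * (log B - s * log V) - β * |log B - s * log V|) :=
          mul_le_mul_of_nonneg_left h1 (mul_nonneg (hQN x) hV.le)
      _ = P * (V * exp (ρ * (log B - s * log V))) * exp (-(β * s * |log V - log B / s|)) := by
          rw [habs, sub_eq_add_neg, exp_add]; ring_nf
      _ = (P * V ^ s) * B ^ ρ * exp (-(β * s * |log V - log B / s|)) := by rw [h2]; ring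
      _ = _ := by
          rw [← hfac, hB, mul_rpow (by positivity) hG, rpow_add hG0, rpow_one]; ring
  refine (sum_le_sum fun x _ => hterm x).trans ?_
  rw [← Finset.mul_sum]
  exact mul_le_mul_of_nonneg_left (hE _) (by positivity)

end Tilting


/-- Random coding for block codes over a memoryless channel with i.i.d. codewords. -/
theorem exists_code_msgErrorProb_le_of_unionBound_le {W : X → Y → ℝ} (hW : ∀ x y, 0 ≤ W x y)
    {Q : X → ℝ} (hQ : IsProbDist Q) {N M : ℕ} (hM : 0 < M) {ε : ℝ} (hε : 0 < ε)
    (h : ∑ y : Fin N → Y, ∑ x : Fin N → X, (∏ i, Q (x i)) * (∏ i, W (x i) (y i)) *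
      min 1 ((2 * M : ℕ) * ∑ z : Fin N → X with ∏ i, W (x i) (y i) ≤ ∏ i, W (z i) (y i),
        ∏ i, Q (z i)) ≤ ε) :
    ∃ (f : Fin M → Fin N → X) (φ : (Fin N → Y) → Fin M), ∀ m, msgErrorProb W f φ m ≤ 2 * ε := by
  have hw : ∑ x : Fin N → X, ∏ i, Q (x i) = 1 := by
    classical
    rw [← Fintype.piFinset_univ, ← Finset.prod_univ_sum (fun _ => univ) fun _ a => Q a]
    simp [hQ.2]
  have hcode := exists_code_of_unionBound_le
    (V := fun (x : Fin N → X) (y : Fin N → Y) => ∏ i, W (x i) (y i)) (w := fun x => ∏ i, Q (x i))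
    (fun _ _ => prod_nonneg fun i _ => hW _ _) (fun _ => prod_nonneg fun i _ => hQ.1 _) hw hM hε
  exact hcode h

/-- Refined random coding bound: for an input distribution charging two inputs with different
positive likelihoods of some output, i.i.d. random coding gains a factor `N ^ (-(1 + ρ) / 2)`. -/
theorem exists_code_msgErrorProb_le {W : X → Y → ℝ} (hW : ∀ x y, 0 ≤ W x y) {Q : X → ℝ}
    (hQ : IsProbDist Q) {a b : X} {y₀ : Y} (hQa : 0 < Q a) (hQb : 0 < Q b) (ha : 0 < W a y₀)
    (hb : 0 < W b y₀) (hab : W a y₀ ≠ W b y₀) {ρ : ℝ} (hρ0 : 0 < ρ) (hρ1 : ρ < 1) :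
    ∃ K : ℝ, 0 < K ∧ ∀ N M : ℕ, 0 < N → 0 < M →
      ∃ (f : Fin M → Fin N → X) (φ : (Fin N → Y) → Fin M), ∀ m, msgErrorProb W f φ m ≤
        K * (M : ℝ) ^ ρ * (N : ℝ) ^ (-(1 + ρ) / 2) * exp (-N * Eo W Q ρ) := by
  classical
  obtain ⟨hQ0, hQ1⟩ := hQ
  set s : ℝ := 1 / (1 + ρ) with hs
  have hs0 : 0 < s := by positivity
  have hg0 := outputWeight_nonneg hW hQ0 s
  have hg : 0 < outputWeight W Q s y₀ := outputWeight_pos hW hQ0 hQa ha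
  have hq0 := tiltedBackward_nonneg hW hQ0 s
  have hq1 := sum_tiltedBackward_le_one (W := W) (Q := Q) s
  have hqa : 0 < tiltedBackward W Q s y₀ a := div_pos (mul_pos hQa (rpow_pos_of_pos ha s)) hg
  have hqb : 0 < tiltedBackward W Q s y₀ b := div_pos (mul_pos hQb (rpow_pos_of_pos hb s)) hg
  have hv : log (W a y₀) ≠ log (W b y₀) := fun h => hab (log_injOn_pos ha hb h)
  have hβ : 0 < min ρ (1 - ρ) * s := mul_pos (lt_min hρ0 (by linarith)) hs0
  obtain ⟨C, hC, hC'⟩ := sum_prod_mul_exp_neg_abs_le (v := fun y x => log (W x y)) hq0 hq1 hqa hqb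
    hv hs0
  obtain ⟨C₂, hC₂, hC₂'⟩ := sum_prod_mul_exp_neg_abs_le (v := fun y x => log (W x y)) hq0 hq1 hqa
    hqb hv hβ
  set Z := ∑ y, outputWeight W Q s y ^ (1 + ρ) with hZd
  have hZ : 0 < Z := (rpow_pos_of_pos hg (1 + ρ)).trans_le <| single_le_sum
    (f := fun y => outputWeight W Q s y ^ (1 + ρ)) (fun y _ => rpow_nonneg (hg0 y) _) (mem_univ y₀)
  set w : Y → ℝ := fun y => outputWeight W Q s y ^ (1 + ρ) / Z with hw
  have hw0 : ∀ y, 0 ≤ w y := fun y => div_nonneg (rpow_nonneg (hg0 y) _) hZ.le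
  have hw1 : ∑ y, w y = 1 := by rw [hw, ← Finset.sum_div, div_self hZ.ne']
  have hwy : 0 < w y₀ := div_pos (rpow_pos_of_pos hg _) hZ
  set γ := (1 + ρ) / 2 with hγ
  refine ⟨2 * ((2 * C) ^ ρ * C₂ * w y₀ ^ (-γ)), by positivity, fun N M hN hM => ?_⟩
  have hM' : (0:ℝ) < M := by exact_mod_cast hM
  have hN' : (0:ℝ) < N := by exact_mod_cast hN
  set ε := (2 * M * C) ^ ρ * C₂ * Z ^ N * (w y₀ ^ (-γ) * (N : ℝ) ^ (-γ)) with hε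
  have hbound : ∑ y : Fin N → Y, ∑ x : Fin N → X, (∏ i, Q (x i)) * (∏ i, W (x i) (y i)) *
      min 1 ((2 * M : ℕ) * ∑ z : Fin N → X with ∏ i, W (x i) (y i) ≤ ∏ i, W (z i) (y i),
        ∏ i, Q (z i)) ≤ ε := by
    have hy : ∀ y : Fin N → Y, ∑ x : Fin N → X, (∏ i, Q (x i)) * (∏ i, W (x i) (y i)) *
      min 1 ((2 * M : ℕ) * ∑ z : Fin N → X with ∏ i, W (x i) (y i) ≤ ∏ i, W (z i) (y i),
        ∏ i, Q (z i)) ≤ (2 * M * C) ^ ρ * C₂ * Z ^ N *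
          ((∏ i, w (y i)) * (#{i | y i = y₀} + 1 : ℝ) ^ (-γ)) := by
      intro y
      set n : ℝ := #{i | y i = y₀} + 1 with hn
      have hn0 : 0 < n := by positivity
      refine (sum_unionBound_le hW hQ0 hρ0 hs (D := C / √n) (by positivity) (by positivity)
        (hC' N y) (hC₂' N y)).trans (le_of_eq ?_)
      have hG : Z ^ N * ∏ i, w (y i) = (∏ i, outputWeight W Q s (y i)) ^ (1 + ρ) := by
        rw [← finsetProd_rpow _ _ fun i _ => hg0 _]
        simp only [hw, Finset.prod_div_distrib, prod_const, card_univ, Fintype.card_fin]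
        field_simp
      have hpow : (1 / √n) ^ ρ * (1 / √n) = n ^ (-γ) := by
        rw [sqrt_eq_rpow, one_div, ← rpow_neg hn0.le, ← rpow_mul hn0.le, ← rpow_add hn0]
        congr 1; rw [hγ]; ring
      rw [← hG, ← hpow, show ((2 * M : ℕ) : ℝ) * (C / √n) = 2 * M * C * (1 / √n) by
        push_cast; ring, mul_rpow (by positivity) (by positivity)]
      ring
    refine (sum_le_sum fun y _ => hy y).trans ?_
    rw [← Finset.mul_sum]
    exact mul_le_mul_of_nonneg_left
      (sum_prod_mul_count_rpow_le hw0 hw1 hwy hN (by positivity) (by rw [hγ]; linarith))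
      (by positivity)
  obtain ⟨f, φ, hf⟩ := exists_code_msgErrorProb_le_of_unionBound_le hW ⟨hQ0, hQ1⟩ hM
    (by positivity : 0 < ε) hbound
  refine ⟨f, φ, fun m => (hf m).trans (le_of_eq ?_)⟩
  have hexp : exp (-N * Eo W Q ρ) = Z ^ N := by
    have : Eo W Q ρ = -log Z := rfl
    rw [this, neg_mul_neg, exp_nat_mul, exp_log hZ]
  rw [hexp, hε, show (2 * M * C : ℝ) = 2 * C * M by ring, mul_rpow (by positivity) hM'.le,
    show -(1 + ρ) / 2 = -γ by rw [hγ]; ring]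
  ring

section Exponent

variable {U T : Type} [Fintype U] [Fintype T] {W : U → T → ℝ} {Q : U → ℝ}

/-- The sum inside the logarithm of Gallager's function. -/
noncomputable def gallagerSum (W : X → Y → ℝ) (Q : X → ℝ) (ρ : ℝ) : ℝ :=
  ∑ y, outputWeight W Q (1 / (1 + ρ)) y ^ (1 + ρ)

theorem Eo_eq_neg_log_gallagerSum (ρ : ℝ) : Eo W Q ρ = -log (gallagerSum W Q ρ) := rfl

theorem IsDMC.le_one {U T : Type} [Fintype T] {W : U → T → ℝ} (hW : IsDMC W) (x : U) (y : T) :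
    W x y ≤ 1 :=
  hW.2 x ▸ single_le_sum (fun y _ => hW.1 x y) (mem_univ y)

theorem one_le_card_rpow_mul_gallagerSum (hW : IsDMC W) (hQ : IsProbDist Q) {ρ : ℝ} (hρ : 0 ≤ ρ) :
    1 ≤ (Fintype.card T : ℝ) ^ ρ * gallagerSum W Q ρ := by
  have hs : 1 / (1 + ρ) ≤ 1 := by rw [div_le_one (by positivity)]; linarith
  have h1 : 1 ≤ ∑ y, outputWeight W Q (1 / (1 + ρ)) y := by
    simp only [outputWeight]
    rw [Finset.sum_comm]
    refine hQ.2.symm.le.trans (sum_le_sum fun x _ => ?_)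
    rw [← Finset.mul_sum]
    refine le_mul_of_one_le_right (hQ.1 x) ?_
    refine (hW.2 x).symm.le.trans (sum_le_sum fun y _ => ?_)
    calc W x y = W x y ^ (1:ℝ) := (rpow_one _).symm
      _ ≤ _ := rpow_le_rpow_of_exponent_ge' (hW.1 x y) (hW.le_one x y) (by positivity) hs
  have h2 := rpow_sum_le_const_mul_sum_rpow_of_nonneg (p := 1 + ρ) univ (by linarith)
    fun y _ => outputWeight_nonneg hW.1 hQ.1 (1 / (1 + ρ)) y
  rw [add_sub_cancel_left] at h2
  exact (one_le_rpow h1 (by positivity)).trans h2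

theorem gallagerSum_pos (hW : IsDMC W) (hQ : IsProbDist Q) {ρ : ℝ} (hρ : 0 ≤ ρ) :
    0 < gallagerSum W Q ρ :=
  pos_of_mul_pos_right (one_pos.trans_le (one_le_card_rpow_mul_gallagerSum hW hQ hρ))
    (by positivity)

theorem Eo_le_mul_log_card (hW : IsDMC W) (hQ : IsProbDist Q) {ρ : ℝ} (hρ : 0 ≤ ρ) :
    Eo W Q ρ ≤ ρ * log (Fintype.card T) := by
  have h := one_le_card_rpow_mul_gallagerSum hW hQ hρ
  have hF := gallagerSum_pos hW hQ hρ
  have hc : 0 < (Fintype.card T : ℝ) ^ ρ := pos_of_mul_pos_left (one_pos.trans_le h) hF.le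
  have h2 := log_nonneg h
  rw [log_mul hc.ne' hF.ne'] at h2
  rw [Eo_eq_neg_log_gallagerSum]
  have h3 : log ((Fintype.card T : ℝ) ^ ρ) = ρ * log (Fintype.card T) := by
    rcases eq_or_ne (Fintype.card T : ℝ) 0 with h0 | h0
    · rw [h0] at hc ⊢
      rcases eq_or_ne ρ 0 with rfl | hρ0
      · simp
      · simp [zero_rpow hρ0] at hc
    · exact log_rpow (lt_of_le_of_ne (by positivity) h0.symm) ρ
  linarith

theorem Eo_nonneg (hW : IsDMC W) (hQ : IsProbDist Q) {ρ : ℝ} (hρ : 0 ≤ ρ) : 0 ≤ Eo W Q ρ := by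
  rw [Eo_eq_neg_log_gallagerSum, neg_nonneg]
  refine log_nonpos (gallagerSum_pos hW hQ hρ).le ?_
  have h : ∀ y, outputWeight W Q (1 / (1 + ρ)) y ^ (1 + ρ) ≤ ∑ x, Q x * W x y := by
    intro y
    refine (rpow_arith_mean_le_arith_mean_rpow univ Q (fun x => W x y ^ (1 / (1 + ρ)))
      (fun x _ => hQ.1 x) hQ.2 (fun x _ => rpow_nonneg (hW.1 x y) _) (by linarith)).trans
      (le_of_eq ?_)
    refine sum_congr rfl fun x _ => ?_
    rw [← rpow_mul (hW.1 x y), one_div, inv_mul_cancel₀ (by positivity), rpow_one]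
  refine (sum_le_sum fun y _ => h y).trans (le_of_eq ?_)
  rw [Finset.sum_comm]
  simp [← Finset.mul_sum, hW.2, hQ.2]

theorem gallagerSum_zero (hW : IsDMC W) (hQ : IsProbDist Q) : gallagerSum W Q 0 = 1 := by
  simp only [gallagerSum, outputWeight, add_zero, div_one, rpow_one]
  rw [Finset.sum_comm]
  simp [← Finset.mul_sum, hW.2, hQ.2]

theorem Eo_zero (hW : IsDMC W) (hQ : IsProbDist Q) : Eo W Q 0 = 0 := by
  rw [Eo_eq_neg_log_gallagerSum, gallagerSum_zero hW hQ, log_one, neg_zero]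

theorem rpow_tangent_le {a b ρ : ℝ} (ha : 0 ≤ a) (hb : 0 ≤ b) (hab : a = 0 → b = 0)
    (hρ : 0 ≤ ρ) : a ^ (1 + ρ) + (1 + ρ) * (a ^ ρ * (b - a)) ≤ b ^ (1 + ρ) := by
  rcases ha.eq_or_lt with rfl | ha
  · simp [hab rfl]
  have h := one_add_mul_self_le_rpow_one_add (s := b / a - 1) (p := 1 + ρ)
    (by linarith [div_nonneg hb ha.le]) (by linarith)
  rw [add_sub_cancel, div_rpow hb ha.le, le_div_iff₀ (by positivity)] at h
  refine le_of_eq_of_le ?_ h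
  rw [rpow_add ha, rpow_one]
  field_simp

theorem isProbDist_uniform [Nonempty U] : IsProbDist fun _ : U => (Fintype.card U : ℝ)⁻¹ :=
  ⟨fun _ => by positivity, by simp⟩

/-- The uniform input distribution is optimal for Gallager symmetric channels. -/
theorem GallagerSymmetric.Eo_le_uniform [Nonempty U] (hsym : GallagerSymmetric W) (hW : IsDMC W)
    (hQ : IsProbDist Q) {ρ : ℝ} (hρ : 0 ≤ ρ) :
    Eo W Q ρ ≤ Eo W (fun _ => (Fintype.card U : ℝ)⁻¹) ρ := by
  obtain ⟨cls, hrow, hcol⟩ := hsym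
  set s := 1 / (1 + ρ) with hs
  have hs0 : 0 < s := by positivity
  set u : U → ℝ := fun _ => (Fintype.card U : ℝ)⁻¹ with hu
  have hu' : IsProbDist u := isProbDist_uniform
  have hupos : ∀ x, 0 < u x := fun x => by simp only [hu]; positivity
  have hg : ∀ y y', cls y = cls y' → outputWeight W u s y = outputWeight W u s y' := by
    intro y y' h
    have := congrArg (fun m => (m.map fun t : ℝ => t ^ s).sum) (hcol y y' h)
    simp only [Multiset.map_map, Function.comp_def] at this
    simp only [outputWeight, hu, ← Finset.mul_sum]
    exact congrArg _ this
  have hr : ∀ x x', ∑ y, W x y ^ s * outputWeight W u s y ^ ρ =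
      ∑ y, W x' y ^ s * outputWeight W u s y ^ ρ := by
    intro x x'
    rw [← sum_fiberwise_of_maps_to (g := cls) (t := univ.image cls)
        fun y _ => mem_image_of_mem cls (mem_univ y),
      ← sum_fiberwise_of_maps_to (g := cls) (t := univ.image cls)
        fun y _ => mem_image_of_mem cls (mem_univ y)]
    refine sum_congr rfl fun l hl => ?_
    obtain ⟨y₀, -, rfl⟩ := mem_image.1 hl
    have hfib : ∀ z, ∑ y with cls y = cls y₀, W z y ^ s * outputWeight W u s y ^ ρ =
        (∑ y with cls y = cls y₀, W z y ^ s) * outputWeight W u s y₀ ^ ρ := by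
      intro z
      rw [Finset.sum_mul]
      exact sum_congr rfl fun y hy => by rw [hg y y₀ (mem_filter.1 hy).2]
    have := congrArg (fun m => (m.map fun t : ℝ => t ^ s).sum) (hrow (cls y₀) x x')
    simp only [Multiset.map_map, Function.comp_def] at this
    rw [hfib, hfib]
    exact congrArg (· * _) this
  have hc : ∀ {P : U → ℝ}, IsProbDist P → ∀ x₀, ∑ y, outputWeight W u s y ^ ρ *
      outputWeight W P s y = ∑ y, W x₀ y ^ s * outputWeight W u s y ^ ρ := by
    intro P hP x₀
    calc _ = ∑ x, P x * ∑ y, W x y ^ s * outputWeight W u s y ^ ρ := by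
          simp only [Finset.mul_sum]
          rw [Finset.sum_comm]
          refine sum_congr rfl fun y _ => ?_
          conv_lhs => rw [outputWeight.eq_def W P, Finset.mul_sum]
          exact sum_congr rfl fun x _ => by ring
      _ = ∑ x, P x * ∑ y, W x₀ y ^ s * outputWeight W u s y ^ ρ :=
          sum_congr rfl fun x _ => by rw [hr x x₀]
      _ = _ := by rw [← Finset.sum_mul, hP.2, one_mul]
  rw [Eo_eq_neg_log_gallagerSum, Eo_eq_neg_log_gallagerSum, neg_le_neg_iff]
  refine log_le_log (gallagerSum_pos hW hu' hρ) ?_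
  have htan : ∀ y, outputWeight W u s y ^ (1 + ρ) + (1 + ρ) * (outputWeight W u s y ^ ρ *
      (outputWeight W Q s y - outputWeight W u s y)) ≤ outputWeight W Q s y ^ (1 + ρ) := by
    intro y
    refine rpow_tangent_le (outputWeight_nonneg hW.1 hu'.1 s y)
      (outputWeight_nonneg hW.1 hQ.1 s y) (fun h0 => ?_) hρ
    refine sum_eq_zero fun x _ => ?_
    have := (sum_eq_zero_iff_of_nonneg fun x _ =>
      mul_nonneg (hu'.1 x) (rpow_nonneg (hW.1 x y) s)).1 h0 x (mem_univ x)
    rw [(mul_eq_zero.1 this).resolve_left (hupos x).ne', mul_zero]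
  have hsum := sum_le_sum fun y (_ : y ∈ univ) => htan y
  obtain ⟨x₀⟩ := ‹Nonempty U›
  rw [Finset.sum_add_distrib, ← Finset.mul_sum] at hsum
  simp only [mul_sub, Finset.sum_sub_distrib, hc hQ x₀, hc hu' x₀, sub_self, mul_zero,
    add_zero] at hsum
  exact hsum

theorem hasDerivAt_const_rpow_one_div {a : ℝ} (ha : 0 ≤ a) {ρ : ℝ} (hρ : -1 < ρ) :
    HasDerivAt (fun r => a ^ (1 / (1 + r))) (-(a ^ (1 / (1 + ρ)) * log a / (1 + ρ) ^ 2)) ρ := by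
  have h1 : 0 < 1 + ρ := by linarith
  rcases ha.eq_or_lt with rfl | ha
  · refine (hasDerivAt_const ρ (0:ℝ)).congr_of_eventuallyEq ?_ |>.congr_deriv (by simp)
    filter_upwards [lt_mem_nhds hρ] with r hr
    exact zero_rpow (one_div_pos.2 (by linarith)).ne'
  · have hd : HasDerivAt (fun r : ℝ => 1 / (1 + r)) (-1 / (1 + ρ) ^ 2) ρ := by
      simpa only [one_div] using ((hasDerivAt_id' ρ).const_add 1).fun_inv h1.ne'
    refine (hd.const_rpow ha).congr_deriv ?_
    ring

theorem hasDerivAt_outputWeight (hW : IsDMC W) (y : T) {ρ : ℝ} (hρ : -1 < ρ) :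
    HasDerivAt (fun r => outputWeight W Q (1 / (1 + r)) y)
      (-∑ x, Q x * W x y ^ (1 / (1 + ρ)) * log (W x y) / (1 + ρ) ^ 2) ρ := by
  simp only [outputWeight]
  refine (HasDerivAt.fun_sum fun x _ =>
    (hasDerivAt_const_rpow_one_div (hW.1 x y) hρ).const_mul (Q x)).congr_deriv ?_
  rw [← Finset.sum_neg_distrib]
  exact sum_congr rfl fun x _ => by ring

theorem hasDerivAt_gallagerSum (hW : IsDMC W) (hQ : IsProbDist Q) {ρ : ℝ} (hρ : -1 < ρ) :
    HasDerivAt (gallagerSum W Q)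
      (∑ y, ((-∑ x, Q x * W x y ^ (1 / (1 + ρ)) * log (W x y) / (1 + ρ) ^ 2) * (1 + ρ) *
          outputWeight W Q (1 / (1 + ρ)) y ^ ρ +
        outputWeight W Q (1 / (1 + ρ)) y ^ (1 + ρ) *
          log (outputWeight W Q (1 / (1 + ρ)) y))) ρ := by
  refine HasDerivAt.fun_sum fun y _ => ?_
  have h1 : 0 < 1 + ρ := by linarith
  rcases (outputWeight_nonneg hW.1 hQ.1 (1 / (1 + ρ)) y).eq_or_lt with h0 | hpos
  · have hx : ∀ x, Q x * W x y ^ (1 / (1 + ρ)) = 0 := fun x =>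
      (sum_eq_zero_iff_of_nonneg fun x _ =>
        mul_nonneg (hQ.1 x) (rpow_nonneg (hW.1 x y) _)).1 h0.symm x (mem_univ x)
    refine (hasDerivAt_const ρ (0:ℝ)).congr_of_eventuallyEq ?_ |>.congr_deriv 
      (by simp only [← h0, hx]; simp [zero_rpow h1.ne'])
    filter_upwards [lt_mem_nhds hρ] with r hr
    have hr1 : 0 < 1 + r := by linarith
    have : outputWeight W Q (1 / (1 + r)) y = 0 := by
      refine sum_eq_zero fun x _ => ?_
      rcases mul_eq_zero.1 (hx x) with h | h
      · rw [h, zero_mul]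
      · rw [(rpow_eq_zero (hW.1 x y) (one_div_pos.2 h1).ne').1 h,
          zero_rpow (one_div_pos.2 hr1).ne', mul_zero]
    rw [this, zero_rpow hr1.ne']
  · refine ((hasDerivAt_outputWeight hW y hρ).rpow ((hasDerivAt_id ρ).const_add 1)
      hpos).congr_deriv ?_
    simp only [id_eq, add_sub_cancel_left]
    ring

theorem differentiableAt_Eo (hW : IsDMC W) (hQ : IsProbDist Q) {ρ : ℝ} (hρ : 0 ≤ ρ) :
    DifferentiableAt ℝ (Eo W Q) ρ :=
  ((hasDerivAt_gallagerSum hW hQ (by linarith)).differentiableAt.log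
    (gallagerSum_pos hW hQ hρ).ne').neg

theorem hasDerivAt_Eo_zero (hW : IsDMC W) (hQ : IsProbDist Q) :
    HasDerivAt (Eo W Q) (mutualInfo W Q) 0 := by
  have h := ((hasDerivAt_gallagerSum hW hQ (ρ := 0) (by norm_num)).log
    (gallagerSum_pos hW hQ le_rfl).ne').neg
  refine h.congr_deriv ?_
  rw [gallagerSum_zero hW hQ, div_one, mutualInfo, Finset.sum_comm, ← Finset.sum_neg_distrib]
  refine sum_congr rfl fun y _ => ?_
  simp only [add_zero, div_one, rpow_one, one_pow, rpow_zero, mul_one]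
  have hg : outputWeight W Q 1 y = ∑ x, Q x * W x y := by simp [outputWeight]
  have hterm : ∀ x, Q x * W x y * log (W x y / ∑ z, Q z * W z y) =
      Q x * W x y * log (W x y) - Q x * W x y * log (outputWeight W Q 1 y) := by
    intro x
    rcases (hQ.1 x).eq_or_lt with h0 | hx
    · simp [← h0]
    rcases (hW.1 x y).eq_or_lt with h0 | hxy
    · simp [← h0]
    rw [← hg, log_div hxy.ne' (outputWeight_pos hW.1 hQ.1 hx hxy).ne']
    ring
  rw [sum_congr rfl fun x _ => hterm x, Finset.sum_sub_distrib, ← Finset.sum_mul, ← hg]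
  ring

theorem bddAbove_Er_set (hW : IsDMC W) (R : ℝ) :
    BddAbove {e | ∃ Q, IsProbDist Q ∧ ∃ ρ : ℝ, 0 ≤ ρ ∧ ρ ≤ 1 ∧ e = Eo W Q ρ - ρ * R} := by
  refine ⟨|log (Fintype.card T)| + |R|, ?_⟩
  rintro e ⟨Q, hQ, ρ, h0, h1, rfl⟩
  have h := Eo_le_mul_log_card hW hQ h0
  have h2 : ρ * log (Fintype.card T) ≤ |log (Fintype.card T)| :=
    (mul_le_mul_of_nonneg_left (le_abs_self _) h0).trans
      (mul_le_of_le_one_left (abs_nonneg _) h1)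
  have h3 : -(ρ * R) ≤ |R| := by
    rw [← mul_neg]
    exact (mul_le_mul_of_nonneg_left (neg_le_abs R) h0).trans
      (mul_le_of_le_one_left (abs_nonneg _) h1)
  linarith

theorem le_Er (hW : IsDMC W) (hQ : IsProbDist Q) {ρ : ℝ} (h0 : 0 ≤ ρ) (h1 : ρ ≤ 1) (R : ℝ) :
    Eo W Q ρ - ρ * R ≤ Er W R :=
  le_csSup (bddAbove_Er_set hW R) ⟨Q, hQ, ρ, h0, h1, rfl⟩

theorem Er_pos_of_lt_capacity [Nonempty U] (hW : IsDMC W) {R : ℝ} (hR : R < capacity W) :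
    0 < Er W R := by
  have hne : {r | ∃ Q, IsProbDist Q ∧ r = mutualInfo W Q}.Nonempty :=
    ⟨_, _, isProbDist_uniform, rfl⟩
  obtain ⟨_, ⟨Q, hQ, rfl⟩, hI⟩ := exists_lt_of_lt_csSup hne hR
  have hd : HasDerivAt (fun ρ => Eo W Q ρ - ρ * R) (mutualInfo W Q - R) 0 := by
    simpa using (hasDerivAt_Eo_zero hW hQ).fun_sub ((hasDerivAt_id (0:ℝ)).mul_const R)
  have hev := (hasDerivAt_iff_tendsto_slope.1 hd).eventually (lt_mem_nhds (sub_pos.2 hI))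
  have hev' := (hev.filter_mono (nhdsWithin_mono 0 fun x (hx : x ∈ Set.Ioi (0:ℝ)) =>
    (Set.mem_Ioi.1 hx).ne')).and (Ioo_mem_nhdsGT one_pos)
  obtain ⟨ρ, hρ, hρ0, hρ1⟩ := hev'.exists
  refine lt_of_lt_of_le ?_ (le_Er hW hQ hρ0.le hρ1.le R)
  rw [slope_def_field, Eo_zero hW hQ] at hρ
  simpa [hρ0] using (div_pos_iff_of_pos_right (by simpa using hρ0)).1 hρ

theorem GallagerSymmetric.exists_Er_eq [Nonempty U] (hsym : GallagerSymmetric W) (hW : IsDMC W)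
    (R : ℝ) : ∃ ρ : ℝ, 0 ≤ ρ ∧ ρ ≤ 1 ∧
      Er W R = Eo W (fun _ => (Fintype.card U : ℝ)⁻¹) ρ - ρ * R := by
  set u : U → ℝ := fun _ => (Fintype.card U : ℝ)⁻¹
  have hu : IsProbDist u := isProbDist_uniform
  obtain ⟨ρ, ⟨h0, h1⟩, hmax⟩ := isCompact_Icc.exists_isMaxOn (Set.nonempty_Icc.2 zero_le_one)
    (f := fun ρ => Eo W u ρ - ρ * R) fun ρ hρ =>
      ((differentiableAt_Eo hW hu hρ.1).continuousAt.sub (by fun_prop)).continuousWithinAt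
  refine ⟨ρ, h0, h1, le_antisymm ?_ (le_Er hW hu h0 h1 R)⟩
  refine csSup_le ⟨_, u, hu, 0, le_rfl, zero_le_one, rfl⟩ ?_
  rintro e ⟨Q, hQ, r, hr0, hr1, rfl⟩
  exact (sub_le_sub_right (hsym.Eo_le_uniform hW hQ hr0) _).trans (hmax ⟨hr0, hr1⟩)

theorem Er_eq_ESP_of_Rcr_lt [Nonempty U] (hW : IsDMC W) {R : ℝ} (hR : Rcr W < R) :
    Er W R = ESP W R := by
  have hne : {R | ∀ R', R ≤ R' → Er W R' = ESP W R'}.Nonempty := by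
    refine ⟨log (Fintype.card T), fun R' hR' => ?_⟩
    have hu : IsProbDist fun _ : U => (Fintype.card U : ℝ)⁻¹ := isProbDist_uniform
    have hle : ∀ {P : U → ℝ} {ρ : ℝ}, IsProbDist P → 0 ≤ ρ → Eo W P ρ - ρ * R' ≤ 0 :=
      fun hP hρ => sub_nonpos.2 <|
        (Eo_le_mul_log_card hW hP hρ).trans (mul_le_mul_of_nonneg_left hR' hρ)
    have hmem : (0:ℝ) = Eo W (fun _ : U => (Fintype.card U : ℝ)⁻¹) 0 - 0 * R' := by
      rw [Eo_zero hW hu]; ring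
    have h1 : IsGreatest {e | ∃ Q, IsProbDist Q ∧ ∃ ρ : ℝ, 0 ≤ ρ ∧ ρ ≤ 1 ∧
        e = Eo W Q ρ - ρ * R'} 0 := by
      refine ⟨⟨_, hu, 0, le_rfl, zero_le_one, hmem⟩, ?_⟩
      rintro e ⟨P, hP, ρ, h0, -, rfl⟩
      exact hle hP h0
    have h2 : IsGreatest (ESPset W R') 0 := by
      refine ⟨⟨_, hu, 0, le_rfl, hmem⟩, ?_⟩
      rintro e ⟨P, hP, ρ, h0, rfl⟩
      exact hle hP h0
    exact h1.csSup_eq.trans h2.csSup_eq.symm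
  obtain ⟨r, hr, hrR⟩ := exists_lt_of_csInf_lt hne hR
  exact hr R hrR.le

theorem Eo_sub_le_Er [Nonempty U] (hW : IsDMC W) {R : ℝ} (hR1 : Rcr W < R) (hR2 : R < capacity W)
    (hQ : IsProbDist Q) {ρ : ℝ} (hρ : 0 ≤ ρ) : Eo W Q ρ - ρ * R ≤ Er W R := by
  have hpos := Er_pos_of_lt_capacity hW hR2
  rw [Er_eq_ESP_of_Rcr_lt hW hR1] at hpos ⊢
  have hb : BddAbove (ESPset W R) := by
    by_contra hb
    rw [ESP, Real.sSup_of_not_bddAbove hb] at hpos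
    exact lt_irrefl _ hpos
  exact le_csSup hb ⟨Q, hQ, ρ, hρ, rfl⟩

theorem rate_nonneg_of_Rcr_lt [Nonempty U] (hW : IsDMC W) {R : ℝ} (hR1 : Rcr W < R)
    (hR2 : R < capacity W) : 0 ≤ R := by
  by_contra! hneg
  have hu : IsProbDist fun _ : U => (Fintype.card U : ℝ)⁻¹ := isProbDist_uniform
  have hE : 0 < Er W R := Er_pos_of_lt_capacity hW hR2
  have hρ : 0 ≤ (Er W R + 1) / -R := div_nonneg (by linarith) (by linarith)
  have h1 := Eo_sub_le_Er hW hR1 hR2 hu hρ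
  have h2 := Eo_nonneg hW hu hρ
  have h3 : (Er W R + 1) / -R * R = -(Er W R + 1) := by
    have := hneg.ne; field_simp
  linarith

/-- Strictly between the critical rate and capacity, the optimal parameter of the random coding
exponent is interior, and it is the negative of the slope of the exponent. -/
theorem GallagerSymmetric.Er_eq_of_hasDerivAt [Nonempty U] (hsym : GallagerSymmetric W)
    (hW : IsDMC W) {R d : ℝ} (hR1 : Rcr W < R) (hR2 : R < capacity W)
    (hd : HasDerivAt (Er W) d R) :
    0 < |d| ∧ |d| < 1 ∧ Er W R = Eo W (fun _ => (Fintype.card U : ℝ)⁻¹) |d| - |d| * R := by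
  obtain ⟨ρ, h0, h1, hE⟩ := hsym.exists_Er_eq hW R
  set u : U → ℝ := fun _ => (Fintype.card U : ℝ)⁻¹
  have hu : IsProbDist u := isProbDist_uniform
  have hmin : IsLocalMin (fun r => Er W r + ρ * r) R := Filter.Eventually.of_forall fun r => by
    have := le_Er hW hu h0 h1 r
    change Er W R + ρ * R ≤ Er W r + ρ * r
    linarith
  have hdρ : d + ρ = 0 :=
    hmin.hasDerivAt_eq_zero (by simpa using hd.fun_add ((hasDerivAt_id R).const_mul ρ))
  have habs : |d| = ρ := by
    rw [show d = -ρ by linarith, abs_neg, abs_of_nonneg h0]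
  rw [habs]
  refine ⟨h0.lt_of_ne ?_, h1.lt_of_ne ?_, hE⟩
  · rintro rfl
    have := Er_pos_of_lt_capacity hW hR2
    rw [hE, Eo_zero hW hu] at this
    simp at this
  · rintro rfl
    obtain ⟨R', hR1', hR'⟩ := exists_between hR1
    have hslope := hasDerivAt_iff_tendsto_slope.1
      (differentiableAt_Eo hW hu zero_le_one).hasDerivAt
    have hle : ∀ r, 0 ≤ r → r ≤ 1 → Eo W u r - r * R ≤ Eo W u 1 - 1 * R := fun r hr0 hr1 =>
      hE ▸ le_Er hW hu hr0 hr1 R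
    have hE' : Er W R' ≤ Eo W u 1 - 1 * R' := by
      obtain ⟨r, hr0, hr1, hr⟩ := hsym.exists_Er_eq hW R'
      have := hle r hr0 hr1
      rw [hr]
      nlinarith
    have hleft : R ≤ deriv (Eo W u) 1 := by
      refine ge_of_tendsto (hslope.mono_left (nhdsWithin_mono 1
        fun x (hx : x ∈ Set.Iio (1:ℝ)) => (Set.mem_Iio.1 hx).ne)) ?_
      filter_upwards [Ioo_mem_nhdsLT zero_lt_one] with r hr
      rw [slope_def_field, le_div_iff_of_neg (by linarith [hr.2])]
      linarith [hle r hr.1.le hr.2.le]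
    have hright : deriv (Eo W u) 1 ≤ R' := by
      refine le_of_tendsto (hslope.mono_left (nhdsWithin_mono 1
        fun x (hx : x ∈ Set.Ioi (1:ℝ)) => (Set.mem_Ioi.1 hx).ne')) ?_
      filter_upwards [self_mem_nhdsWithin] with r hr
      have hr' : (1:ℝ) < r := hr
      rw [slope_def_field, div_le_iff₀ (by linarith)]
      have := Eo_sub_le_Er hW hR1' (hR'.trans hR2) hu (zero_le_one.trans hr'.le)
      linarith
    linarith

end Exponent

/-- **Theorem 1(i)** (nonsingular achievability): for a symmetric nonsingular DMC with
`R_cr < C(W)` and any rate `R_cr < R < C(W)`, there is a constant `K₁ > 0` such that for every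
blocklength `N ≥ 1` there is an `(N,R)` code whose maximal error probability is at most
`K₁ · N^{-(1+|E_r'(R)|)/2} · exp(-N E_r(R))`. -/
theorem statement0 {X Y : Type} [Fintype X] [Fintype Y] [Nonempty X] [Nonempty Y]
    (W : X → Y → ℝ) (hW : IsDMC W) (hsym : GallagerSymmetric W) (hns : ¬ Singular W)
    (hcr : Rcr W < capacity W)
    (R : ℝ) (hR1 : Rcr W < R) (hR2 : R < capacity W)
    (Er' : ℝ) (hEr' : HasDerivAt (Er W) Er' R) :
    ∃ K₁ : ℝ, 0 < K₁ ∧ ∀ N : ℕ, 0 < N →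
      ∃ (f : Fin (Mof N R) → Fin N → X) (φ : (Fin N → Y) → Fin (Mof N R)),
        ∀ m, msgErrorProb W f φ m ≤
          K₁ * (N : ℝ) ^ (-(1 + |Er'|) / 2) * Real.exp (-(N : ℝ) * Er W R) := by
  obtain ⟨h0, h1, hE⟩ := hsym.Er_eq_of_hasDerivAt hW hR1 hR2 hEr'
  have hR0 := rate_nonneg_of_Rcr_lt hW hR1 hR2
  simp only [Singular, not_forall] at hns
  obtain ⟨a, b, y, hpos, hab⟩ := hns
  have ha : 0 < W a y := pos_of_mul_pos_left hpos (hW.1 b y)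
  have hb : 0 < W b y := pos_of_mul_pos_right hpos (hW.1 a y)
  have hcard : 0 < (Fintype.card X : ℝ)⁻¹ := by positivity
  set ρ := |Er'|
  obtain ⟨K, hK, hcode⟩ := exists_code_msgErrorProb_le hW.1 (isProbDist_uniform (U := X)) hcard
    hcard ha hb hab h0 h1
  refine ⟨K * 2 ^ ρ, by positivity, fun N hN => ?_⟩
  obtain ⟨f, φ, hf⟩ := hcode N (Mof N R) hN (Nat.ceil_pos.2 (exp_pos _))
  refine ⟨f, φ, fun m => (hf m).trans ?_⟩
  have hM : (Mof N R : ℝ) ≤ 2 * exp (N * R) := by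
    have h2 : (Mof N R : ℝ) < exp (N * R) + 1 := Nat.ceil_lt_add_one (exp_pos _).le
    have h3 : 1 ≤ exp (N * R) := one_le_exp (by positivity)
    linarith
  have hMρ : (Mof N R : ℝ) ^ ρ ≤ 2 ^ ρ * exp (N * R * ρ) := by
    rw [exp_mul, ← mul_rpow zero_le_two (exp_pos _).le]
    exact rpow_le_rpow (Nat.cast_nonneg _) hM h0.le
  calc _ ≤ K * (2 ^ ρ * exp (N * R * ρ)) * (N : ℝ) ^ (-(1 + ρ) / 2) *
        exp (-N * Eo W (fun _ => (Fintype.card X : ℝ)⁻¹) ρ) := by gcongr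
    _ = K * 2 ^ ρ * (N : ℝ) ^ (-(1 + ρ) / 2) * (exp (N * R * ρ) *
        exp (-N * Eo W (fun _ => (Fintype.card X : ℝ)⁻¹) ρ)) := by ring
    _ = _ := by
        rw [← exp_add, hE]
        congr 2
        ring
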